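/- Let A be a live weakly-hierarchical visibly pushdown automaton and ≈ a reachability-aware quotienting (RAQ) relation for A. Then for every matched-return word w over Σ and every initial run ρ = ([p_0], ⊥) ([p_1], [σ_1]) … ([p_n], [σ_n]) of the quotient VPA A/≈ on w (with p_0 ∈ Q0), there exists an initial run ρ' = (q_0', ⊥) (q_1', σ_1') … (q_n', σ_n') of A on w such that q_0' ∈ Q0 and, for all i, q_i' ∈ [p_i] and σ_i' ∈ [σ_i]. -/

import Mathlib

/-- The kind of a symbol in a visibly pushdown alphabet:
internal, call, or return. -/
inductive SymKind : Type
  | int | call | ret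
deriving DecidableEq

/-- A weakly-hierarchical visibly pushdown automaton over states `Q` and
alphabet `S`.  The partition of the alphabet is given by `kind`; the
bottom-of-stack symbol is implicit (stacks are lists of states, the empty
list playing the role of `⊥`, and the head of the list being the topmost
symbol). -/
structure VPA (Q : Type) (S : Type) where
  kind : S → SymKind
  δi : Q → S → Q → Prop
  δc : Q → S → Q → Prop
  δr : Q → S → Q → Q → Prop
  Q0 : Set Q
  F : Set Q
  Q0_nonempty : Q0.Nonempty
  δi_kind : ∀ p a q, δi p a q → kind a = SymKind.int
  δc_kind : ∀ p c q, δc p c q → kind c = SymKind.call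
  δr_kind : ∀ p r qh q, δr p r qh q → kind r = SymKind.ret

namespace VPA

variable {Q S : Type}

/-- A configuration: current state together with the stack
(head = topmost symbol; `[]` = the empty stack `⊥`). -/
abbrev Config (Q : Type) := Q × List Q

/-- One step of the automaton on a symbol. Internal symbols leave the stack
unchanged, call symbols push the current state, return symbols pop the
matching topmost stack symbol. -/
def Step (A : VPA Q S) (c : Config Q) (s : S) (c' : Config Q) : Prop :=
  match A.kind s with
  | SymKind.int  => A.δi c.1 s c'.1 ∧ c'.2 = c.2
  | SymKind.call => A.δc c.1 s c'.1 ∧ c'.2 = c.1 :: c.2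
  | SymKind.ret  => ∃ qh, A.δr c.1 s qh c'.1 ∧ c.2 = qh :: c'.2

/-- `ρ` is a run of `A` on the word `w`. -/
def IsRunOn (A : VPA Q S) (w : List S) (ρ : Fin (w.length + 1) → Config Q) : Prop :=
  ∀ i : Fin w.length, A.Step (ρ i.castSucc) (w.get i) (ρ i.succ)

/-- A run is initial if it starts in an initial state with the empty stack `⊥`. -/
def IsInitial (A : VPA Q S) {n : ℕ} (ρ : Fin (n + 1) → Config Q) : Prop :=
  (ρ 0).1 ∈ A.Q0 ∧ (ρ 0).2 = []

/-- `A` accepts `w` if some initial run of `A` on `w` ends in an accepting state. -/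
def Accepts (A : VPA Q S) (w : List S) : Prop :=
  ∃ ρ : Fin (w.length + 1) → Config Q,
    A.IsRunOn w ρ ∧ A.IsInitial ρ ∧ (ρ (Fin.last w.length)).1 ∈ A.F

/-- The language of `A`. -/
def lang (A : VPA Q S) : Set (List S) := {w | A.Accepts w}

/-- A configuration is reachable if it occurs in some initial run of `A`. -/
def Reachable (A : VPA Q S) (c : Config Q) : Prop :=
  ∃ (w : List S) (ρ : Fin (w.length + 1) → Config Q),
    A.IsRunOn w ρ ∧ A.IsInitial ρ ∧ ∃ i, ρ i = c

/-- `tops A q` = set of topmost stack symbols of reachable stacks for `q`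
(`none` plays the role of the bottom-of-stack symbol `⊥`). -/
def tops (A : VPA Q S) (q : Q) : Set (Option Q) :=
  {t | ∃ σ : List Q, A.Reachable (q, σ) ∧ σ.head? = t}

/-- `A` is live: every state has outgoing transitions for every internal and
call symbol, and has an outgoing return transition for return symbol `s` and
stack symbol `qh` if and only if `qh` is the topmost symbol of some
reachable stack. -/
def Live (A : VPA Q S) : Prop :=
  (∀ q s, A.kind s = SymKind.int → ∃ q', A.δi q s q') ∧
  (∀ q s, A.kind s = SymKind.call → ∃ q', A.δc q s q') ∧
  (∀ q s qh, A.kind s = SymKind.ret →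
    ((∃ q', A.δr q s qh q') ↔ some qh ∈ A.tops q))

/-- `R` is a reachability-aware quotienting (RAQ) relation for `A`. -/
def IsRAQ (A : VPA Q S) (R : Q → Q → Prop) : Prop :=
  Equivalence R ∧
  ∀ p q, R p q →
    (p ∈ A.F ↔ q ∈ A.F) ∧
    (∀ a p', A.δi p a p' → ∃ q', A.δi q a q' ∧ R p' q') ∧
    (∀ a q', A.δi q a q' → ∃ p', A.δi p a p' ∧ R p' q') ∧
    (∀ c p', A.δc p c p' → ∃ q', A.δc q c q' ∧ R p' q') ∧
    (∀ c q', A.δc q c q' → ∃ p', A.δc p c p' ∧ R p' q') ∧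
    (∀ ph qh, R ph qh →
      ((∀ r p', A.δr p r ph p' → ∃ q', A.δr q r qh q' ∧ R p' q') ∧
       (∀ r q', A.δr q r qh q' → ∃ p', A.δr p r ph p' ∧ R p' q'))
      ∨ some qh ∉ A.tops q ∨ some ph ∉ A.tops p)

/-- The quotient VPA `A/R` for an equivalence relation (setoid) `R` on states. -/
def quot (A : VPA Q S) (R : Setoid Q) : VPA (Quotient R) S where
  kind := A.kind
  δi := fun P a P' => ∃ p p', A.δi p a p' ∧
    Quotient.mk R p = P ∧ Quotient.mk R p' = P'
  δc := fun P c P' => ∃ p p', A.δc p c p' ∧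
    Quotient.mk R p = P ∧ Quotient.mk R p' = P'
  δr := fun P r Ph P' => ∃ p ph p', A.δr p r ph p' ∧
    Quotient.mk R p = P ∧ Quotient.mk R ph = Ph ∧ Quotient.mk R p' = P'
  Q0 := {P | ∃ q ∈ A.Q0, Quotient.mk R q = P}
  F := {P | ∃ q ∈ A.F, Quotient.mk R q = P}
  Q0_nonempty := by
    obtain ⟨q, hq⟩ := A.Q0_nonempty
    exact ⟨Quotient.mk R q, q, hq, rfl⟩
  δi_kind := by rintro P a P' ⟨p, p', h, -, -⟩; exact A.δi_kind p a p' h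
  δc_kind := by rintro P c P' ⟨p, p', h, -, -⟩; exact A.δc_kind p c p' h
  δr_kind := by rintro P r Ph P' ⟨p, ph, p', h, -, -, -⟩; exact A.δr_kind p r ph p' h

end VPA

/-- A word is matched-return if every prefix ending in a return symbol
has strictly more call symbols than return symbols before that return. -/
def MR {S : Type} (kind : S → SymKind) (w : List S) : Prop :=
  ∀ v r, (v ++ [r]) <+: w → kind r = SymKind.ret →
    v.countP (fun s => decide (kind s = SymKind.call)) >
      v.countP (fun s => decide (kind s = SymKind.ret))

namespace VPA

variable {Q S : Type}

/-- A sequence of configurations that follows the first `k` letters of a word from an initial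
configuration witnesses that its `k`-th configuration is reachable. -/
theorem reachable_of_steps (A : VPA Q S) (w : List S) (f : ℕ → Config Q) (k : ℕ)
    (hk : k ≤ w.length) (h0 : (f 0).1 ∈ A.Q0 ∧ (f 0).2 = [])
    (hf : ∀ i (hi : i < w.length), i < k → A.Step (f i) w[i] (f (i + 1))) :
    A.Reachable (f k) := by
  have hlen : (w.take k).length = k := by simp [hk]
  refine ⟨w.take k, fun i => f i, fun i => ?_, h0, ⟨k, by omega⟩, rfl⟩
  have hi : (i : ℕ) < k := by have := i.isLt; omega
  simpa using hf i (by omega) hi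

/-- A step of the quotient automaton can be followed by `A` from every reachable configuration in
the class of its source. -/
theorem exists_step_of_quot_step (A : VPA Q S) (hlive : A.Live) (R : Setoid Q)
    (hRAQ : A.IsRAQ R.r) {c : Config Q} (hc : A.Reachable c) {s : S}
    {d d' : Config (Quotient R)} (hstep : (A.quot R).Step d s d')
    (hstate : Quotient.mk R c.1 = d.1) (hstack : c.2.map (Quotient.mk R) = d.2) :
    ∃ c' : Config Q, A.Step c s c' ∧
      Quotient.mk R c'.1 = d'.1 ∧ c'.2.map (Quotient.mk R) = d'.2 := by
  obtain ⟨q, σ⟩ := c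
  obtain ⟨P, τ⟩ := d
  obtain ⟨P', τ'⟩ := d'
  dsimp only at hstate hstack
  subst hstate hstack
  have hkind : (A.quot R).kind s = A.kind s := rfl
  unfold Step at hstep
  rw [hkind] at hstep
  unfold Step
  cases hs : A.kind s with
  | int =>
    simp only [hs] at hstep ⊢
    obtain ⟨⟨p, p', hp, hpq, rfl⟩, rfl⟩ := hstep
    obtain ⟨q', hq', hpq'⟩ := (hRAQ.2 p q (Quotient.exact hpq)).2.1 s p' hp
    exact ⟨(q', σ), ⟨hq', rfl⟩, (Quotient.sound hpq').symm, rfl⟩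
  | call =>
    simp only [hs] at hstep ⊢
    obtain ⟨⟨p, p', hp, hpq, rfl⟩, rfl⟩ := hstep
    obtain ⟨q', hq', hpq'⟩ := (hRAQ.2 p q (Quotient.exact hpq)).2.2.2.1 s p' hp
    exact ⟨(q', q :: σ), ⟨hq', rfl⟩, (Quotient.sound hpq').symm, rfl⟩
  | ret =>
    simp only [hs] at hstep ⊢
    obtain ⟨_, ⟨p, ph, p', hp, hpq, rfl, rfl⟩, hσ⟩ := hstep
    obtain ⟨qh, σ', rfl, hqh, rfl⟩ := List.map_eq_cons_iff.1 hσ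
    have hq_top : some qh ∈ A.tops q := ⟨qh :: σ', hc, rfl⟩
    have hp_top : some ph ∈ A.tops p := (hlive.2.2 p s ph hs).1 ⟨p', hp⟩
    rcases (hRAQ.2 p q (Quotient.exact hpq)).2.2.2.2.2 ph qh (Quotient.exact hqh.symm) with
      h | h | h
    · obtain ⟨q', hq', hpq'⟩ := h.1 s p' hp
      exact ⟨(q', σ'), ⟨qh, hq', rfl⟩, (Quotient.sound hpq').symm, rfl⟩
    · exact absurd hq_top h
    · exact absurd hp_top h

end VPA

/-- **Corresponding run.**  For a live VPA `A` and a RAQ relation `R`, every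
initial run of the quotient `A/R` on a matched-return word has a corresponding
initial run of `A` whose states and stacks lie classwise in the classes
visited by the quotient run. -/
theorem corresponding_run {Q S : Type} [Fintype Q] [Fintype S]
    (A : VPA Q S) (hlive : A.Live) (R : Setoid Q) (hRAQ : A.IsRAQ R.r)
    (w : List S) (hw : MR A.kind w)
    (ρ : Fin (w.length + 1) → VPA.Config (Quotient R))
    (hrun : (A.quot R).IsRunOn w ρ) (hinit : (A.quot R).IsInitial ρ) :
    ∃ ρ' : Fin (w.length + 1) → VPA.Config Q,
      A.IsRunOn w ρ' ∧ A.IsInitial ρ' ∧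
      ∀ i : Fin (w.length + 1),
        Quotient.mk R (ρ' i).1 = (ρ i).1 ∧
        (ρ' i).2.map (Quotient.mk R) = (ρ i).2 := by
  obtain ⟨⟨q₀, hq₀, hq₀ρ⟩, hρ₀⟩ := hinit
  have key : ∀ k (hk : k ≤ w.length), ∃ f : ℕ → VPA.Config Q,
      ((f 0).1 ∈ A.Q0 ∧ (f 0).2 = []) ∧
      (∀ i (hi : i < w.length), i < k → A.Step (f i) w[i] (f (i + 1))) ∧
      ∀ i (hi : i < w.length + 1), i ≤ k →
        Quotient.mk R (f i).1 = (ρ ⟨i, hi⟩).1 ∧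
        (f i).2.map (Quotient.mk R) = (ρ ⟨i, hi⟩).2 := by
    intro k
    induction k with
    | zero =>
      intro _
      refine ⟨fun _ => (q₀, []), ⟨hq₀, rfl⟩, fun i _ h => absurd h (by omega), ?_⟩
      intro i hi h
      obtain rfl : i = 0 := by omega
      exact ⟨hq₀ρ, hρ₀.symm⟩
    | succ k ih =>
      intro hk
      obtain ⟨f, h0, hf, hclass⟩ := ih (by omega)
      obtain ⟨hstate, hstack⟩ := hclass k (by omega) le_rfl
      obtain ⟨c, hstep, hc⟩ := A.exists_step_of_quot_step hlive R hRAQ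
        (A.reachable_of_steps w f k (by omega) h0 hf) (hrun ⟨k, hk⟩) hstate hstack
      have hold : ∀ i ≤ k, Function.update f (k + 1) c i = f i := fun i hi =>
        Function.update_of_ne (by omega) _ _
      refine ⟨Function.update f (k + 1) c, ?_, ?_, ?_⟩
      · rwa [hold 0 (by omega)]
      · intro i hi hik
        rw [hold i (by omega)]
        rcases Nat.lt_succ_iff_lt_or_eq.1 hik with h | rfl
        · rw [hold (i + 1) h]
          exact hf i hi h
        · rw [Function.update_self]
          exact hstep
      · intro i hi hik
        rcases Nat.le_succ_iff.1 hik with h | rfl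
        · rw [hold i h]
          exact hclass i hi h
        · rw [Function.update_self]
          exact hc
  obtain ⟨f, h0, hf, hclass⟩ := key w.length le_rfl
  exact ⟨fun i => f i, fun i => hf i i.isLt i.isLt, h0,
    fun i => hclass i i.isLt (Nat.lt_succ_iff.1 i.isLt)⟩
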